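/- For every finite set D of k distinct integers contained in [1, h] with h ≥ 3, the singular series satisfies 𝔖(D) = O_k((log log h)^{k-1}); i.e., there is a constant C_k depending only on k such that 𝔖(D) ≤ C_k (log log h)^{k-1} for all h ≥ 3. -/

import Mathlib

open Finset
open scoped Classical

/-- Number of distinct residue classes mod `p` occupied by the elements of `D`. -/
noncomputable def nuD (D : Finset ℤ) (p : ℕ) : ℕ :=
  (D.image (fun d => (Int.cast d : ZMod p))).card

/-- The singular series `𝔖(D) = ∏_p (1 - 1/p)^{-|D|} (1 - ν_D(p)/p)`. -/
noncomputable def singSeries (D : Finset ℤ) : ℝ :=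
  ∏' p : Nat.Primes, ((1 - 1 / ((p : ℕ) : ℝ))⁻¹ ^ D.card * (1 - (nuD D (p : ℕ) : ℝ) / ((p : ℕ) : ℝ)))

/-- The product of the prime powers `p ^ ⌊N / p⌋` over primes `p ≤ N` divides `N!`. -/
theorem prod_primesLE_pow_div_dvd_factorial (N : ℕ) :
    ∏ p ∈ N.primesLE, p ^ (N / p) ∣ N.factorial := by
  refine Finset.prod_dvd_of_isRelPrime ?_ fun p hp ↦ ?_
  · intro p hp q hq hpq
    exact Nat.coprime_iff_isRelPrime.1 (Nat.Coprime.pow _ _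
      ((Nat.coprime_primes (Nat.prime_of_mem_primesLE hp) (Nat.prime_of_mem_primesLE hq)).2 hpq))
  · rw [(Nat.prime_of_mem_primesLE hp).pow_dvd_factorial_iff (b := Nat.log p N + 2) (by omega)]
    simpa using Finset.single_le_sum (f := fun i ↦ N / p ^ i) (fun i _ ↦ Nat.zero_le _)
      (show 1 ∈ Finset.Ico 1 (Nat.log p N + 2) by simp)

/-- Upper bound in Mertens' first theorem. -/
theorem sum_primesLE_log_div_le (N : ℕ) (hN : 1 ≤ N) :
    ∑ p ∈ N.primesLE, Real.log p / p ≤ Real.log N + Real.log 4 := by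
  have hN0 : (0 : ℝ) < N := by exact_mod_cast hN
  have hfloor : ∑ p ∈ N.primesLE, ((N / p : ℕ) : ℝ) * Real.log p ≤ N * Real.log N := by
    have h1 : ((∏ p ∈ N.primesLE, p ^ (N / p) : ℕ) : ℝ) ≤ ((N ^ N : ℕ) : ℝ) := by
      exact_mod_cast (Nat.le_of_dvd N.factorial_pos
        (prod_primesLE_pow_div_dvd_factorial N)).trans N.factorial_le_pow
    have hne : ∀ p ∈ N.primesLE, ((p : ℝ) ^ (N / p)) ≠ 0 := fun p hp ↦
      pow_ne_zero _ (by exact_mod_cast (Nat.prime_of_mem_primesLE hp).ne_zero)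
    push_cast at h1
    have h2 := Real.log_le_log (Finset.prod_pos fun p hp ↦ lt_of_le_of_ne (by positivity)
      (hne p hp).symm) h1
    rw [Real.log_prod hne, Real.log_pow] at h2
    simpa only [Real.log_pow] using h2
  have htheta : ∑ p ∈ N.primesLE, Real.log p ≤ Real.log 4 * N := by
    rw [← Chebyshev.theta_eq_sum_primesLE_log]
    exact Chebyshev.theta_le_log4_mul_x hN0.le
  have hsum : N * ∑ p ∈ N.primesLE, Real.log p / p ≤ N * (Real.log N + Real.log 4) := by
    calc N * ∑ p ∈ N.primesLE, Real.log p / p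
        ≤ ∑ p ∈ N.primesLE, (((N / p : ℕ) : ℝ) * Real.log p + Real.log p) := by
          rw [Finset.mul_sum]
          refine Finset.sum_le_sum fun p hp ↦ ?_
          have h1 : (N : ℝ) / p ≤ ((N / p : ℕ) : ℝ) + 1 := by
            rw [← Nat.floor_div_eq_div (K := ℝ)]
            exact (Nat.lt_floor_add_one _).le
          calc N * (Real.log p / p) = N / p * Real.log p := by ring
            _ ≤ (((N / p : ℕ) : ℝ) + 1) * Real.log p := by gcongr
            _ = _ := by ring
      _ ≤ N * (Real.log N + Real.log 4) := by
          rw [Finset.sum_add_distrib]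
          linarith
  exact le_of_mul_le_mul_left hsum hN0

/-- Partial Euler products of `∑ n⁻ˢ` are bounded by the whole sum. -/
theorem prod_primesLE_one_sub_rpow_inv_le_tsum {s : ℝ} (hs : 1 < s) (N : ℕ) :
    ∏ p ∈ N.primesLE, (1 - 1 / (p : ℝ) ^ s)⁻¹ ≤ ∑' n : ℕ, 1 / (n : ℝ) ^ s := by
  let f : ℕ →* ℝ :=
    { toFun := fun n ↦ 1 / (n : ℝ) ^ s
      map_one' := by simp
      map_mul' := fun m n ↦ by
        rw [Nat.cast_mul, Real.mul_rpow m.cast_nonneg n.cast_nonneg]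
        field_simp }
  have hsum : Summable f := Real.summable_one_div_nat_rpow.2 hs
  have h := EulerProduct.prod_primesBelow_geometric_eq_tsum_smoothNumbers hsum (N + 1)
  change ∏ p ∈ (N + 1).primesBelow, (1 - f p)⁻¹ ≤ ∑' n : ℕ, f n
  rw [h]
  exact hsum.tsum_subtype_le f _ (fun n ↦ show 0 ≤ 1 / (n : ℝ) ^ s by positivity)

/-- Comparison of an Euler factor at `1` with the one at `1 + δ`. -/
theorem one_sub_one_div_inv_le {p δ : ℝ} (hp : 2 ≤ p) (hδ : 0 < δ) :
    (1 - 1 / p)⁻¹ ≤ (1 - 1 / p ^ (1 + δ))⁻¹ * Real.exp (2 * δ * (Real.log p / p)) := by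
  have hp0 : 0 < p := by linarith
  have hinv : 1 / p ≤ 1 / 2 := one_div_le_one_div_of_le (by norm_num) hp
  have hpow : 1 / p ^ (1 + δ) = 1 / p * Real.exp (-(δ * Real.log p)) := by
    rw [Real.rpow_add hp0, Real.rpow_one, Real.rpow_def_of_pos hp0 δ, Real.exp_neg, mul_comm δ]
    field_simp
  have hlog : 0 ≤ Real.log p := Real.log_nonneg (by linarith)
  have hexp1 : Real.exp (-(δ * Real.log p)) ≤ 1 := Real.exp_le_one_iff.2 (by nlinarith)
  have hexp := Real.add_one_le_exp (-(δ * Real.log p))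
  have hip : 0 < 1 / p := by positivity
  have hq : 0 < 1 - 1 / p ^ (1 + δ) := by rw [hpow]; nlinarith
  have hE := Real.add_one_le_exp (2 * δ * (Real.log p / p))
  rw [inv_mul_eq_div, le_div_iff₀ hq, inv_mul_le_iff₀ (by linarith), hpow]
  have ht : Real.log p / p = 1 / p * Real.log p := by ring
  rw [ht] at hE ⊢
  have hu : 0 ≤ δ * (1 / p * Real.log p) := by positivity
  have h1 : 1 - 1 / p * Real.exp (-(δ * Real.log p)) ≤ 1 - 1 / p + δ * (1 / p * Real.log p) := by
    nlinarith
  have h2 : (1 - 1 / p) * (2 * δ * (1 / p * Real.log p) + 1)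
      ≤ (1 - 1 / p) * Real.exp (2 * δ * (1 / p * Real.log p)) :=
    mul_le_mul_of_nonneg_left hE (by linarith)
  nlinarith

open Filter Topology in
/-- Upper bound in Mertens' third theorem. -/
theorem exists_prod_primesLE_le_log :
    ∃ C : ℝ, 0 < C ∧ ∀ N : ℕ, 2 ≤ N →
      ∏ p ∈ N.primesLE, (1 - 1 / (p : ℝ))⁻¹ ≤ C * Real.log N := by
  have hlogN : Tendsto (fun N : ℕ ↦ Real.log N) atTop atTop :=
    Real.tendsto_log_atTop.comp tendsto_natCast_atTop_atTop
  have hs : Tendsto (fun N : ℕ ↦ 1 + 1 / Real.log N) atTop (𝓝[>] 1) := by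
    refine tendsto_nhdsWithin_iff.2 ⟨?_, ?_⟩
    · simpa using hlogN.inv_tendsto_atTop.const_add 1
    · filter_upwards [hlogN.eventually_gt_atTop 0] with N hN
      simpa using hN
  have hzeta := (tendsto_sub_mul_tsum_nat_rpow.comp hs).eventually_le_const one_lt_two
  have hO : (fun N : ℕ ↦ ∏ p ∈ N.primesLE, (1 - 1 / (p : ℝ))⁻¹)
      =O[atTop] (fun N : ℕ ↦ Real.log N) := by
    refine Asymptotics.IsBigO.of_bound (2 * Real.exp (2 * (1 + Real.log 4))) ?_
    filter_upwards [hzeta, hlogN.eventually_ge_atTop 1, eventually_ge_atTop 1] with N hz hl hN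
    have hl0 : 0 < Real.log N := by linarith
    have hnonneg : ∀ p ∈ N.primesLE, 0 ≤ (1 - 1 / (p : ℝ))⁻¹ := fun p hp ↦ by
      have : (1 : ℝ) ≤ p := by exact_mod_cast (Nat.one_lt_of_mem_primesLE hp).le
      exact inv_nonneg.2 (sub_nonneg.2 ((div_le_one (by linarith)).2 this))
    rw [Real.norm_of_nonneg (Finset.prod_nonneg hnonneg), Real.norm_of_nonneg hl0.le]
    set δ := 1 / Real.log N with hδ
    have hδ0 : 0 < δ := by positivity
    have hδ1 : δ ≤ 1 := by rw [hδ, div_le_one hl0]; exact hl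
    have hδl : δ * Real.log N = 1 := by rw [hδ]; field_simp
    have hz' : ∑' n : ℕ, 1 / (n : ℝ) ^ (1 + δ) ≤ 2 * Real.log N := by
      have h1 : δ * ∑' n : ℕ, 1 / (n : ℝ) ^ (1 + δ) ≤ 2 := by
        simpa only [Function.comp_apply, add_sub_cancel_left] using hz
      calc _ = Real.log N * (δ * ∑' n : ℕ, 1 / (n : ℝ) ^ (1 + δ)) := by
            rw [← mul_assoc, mul_comm _ δ, hδl, one_mul]
        _ ≤ Real.log N * 2 := by gcongr
        _ = _ := mul_comm _ _
    have hexp : 2 * δ * ∑ p ∈ N.primesLE, Real.log p / p ≤ 2 * (1 + Real.log 4) := by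
      have h4 : 0 ≤ Real.log 4 := Real.log_nonneg (by norm_num)
      have := mul_le_mul_of_nonneg_left (sum_primesLE_log_div_le N hN) hδ0.le
      nlinarith
    calc ∏ p ∈ N.primesLE, (1 - 1 / (p : ℝ))⁻¹
        ≤ ∏ p ∈ N.primesLE, ((1 - 1 / (p : ℝ) ^ (1 + δ))⁻¹ *
            Real.exp (2 * δ * (Real.log p / p))) :=
          Finset.prod_le_prod hnonneg fun p hp ↦ one_sub_one_div_inv_le
            (by exact_mod_cast Nat.two_le_of_mem_primesLE hp) hδ0
      _ = (∏ p ∈ N.primesLE, (1 - 1 / (p : ℝ) ^ (1 + δ))⁻¹) *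
            Real.exp (2 * δ * ∑ p ∈ N.primesLE, Real.log p / p) := by
          rw [Finset.prod_mul_distrib, ← Real.exp_sum, ← Finset.mul_sum]
      _ ≤ (2 * Real.log N) * Real.exp (2 * (1 + Real.log 4)) :=
          mul_le_mul ((prod_primesLE_one_sub_rpow_inv_le_tsum (by linarith) N).trans hz')
            (Real.exp_le_exp.2 hexp) (Real.exp_pos _).le (by positivity)
      _ = _ := by ring
  obtain ⟨C, hC, h⟩ := Asymptotics.bound_of_isBigO_nat_atTop hO
  refine ⟨C, hC, fun N hN ↦ ?_⟩
  have hl : 0 < Real.log N := Real.log_pos (by exact_mod_cast hN)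
  have := h hl.ne'
  rw [Real.norm_of_nonneg hl.le] at this
  exact (le_abs_self _).trans this

theorem one_le_one_sub_one_div_inv {p : ℕ} (hp : p.Prime) : 1 ≤ (1 - 1 / (p : ℝ))⁻¹ := by
  have h2 : (2 : ℝ) ≤ p := by exact_mod_cast hp.two_le
  have h : 1 / (p : ℝ) ≤ 1 / 2 := one_div_le_one_div_of_le (by norm_num) h2
  have h0 : 0 < 1 / (p : ℝ) := by positivity
  exact (one_le_inv₀ (by linarith)).2 (by linarith)

theorem one_sub_one_div_inv_le_exp {p : ℝ} (hp : 2 ≤ p) :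
    (1 - 1 / p)⁻¹ ≤ Real.exp (2 / p) := by
  have hp0 : 0 < p := by linarith
  have h : 1 / p ≤ 1 / 2 := one_div_le_one_div_of_le (by norm_num) hp
  have h0 : 0 < 1 / p := by positivity
  refine le_trans ?_ (Real.add_one_le_exp _)
  rw [inv_le_iff_one_le_mul₀ (by linarith), div_eq_mul_one_div 2 p]
  nlinarith

theorem card_primeFactors_le_log_div (n : ℕ) (hn : n ≠ 0) :
    (n.primeFactors.card : ℝ) ≤ Real.log n / Real.log 2 := by
  rw [le_div_iff₀ (Real.log_pos one_lt_two), ← Real.log_pow]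
  refine Real.log_le_log (by positivity) ?_
  have h : 2 ^ n.primeFactors.card ≤ n :=
    (Finset.pow_card_le_prod _ _ _ fun p hp ↦ (Nat.prime_of_mem_primeFactors hp).two_le).trans
      (Nat.le_of_dvd (Nat.pos_of_ne_zero hn) n.prod_primeFactors_dvd)
  exact_mod_cast h

/-- The primes dividing `n` contribute to `n / φ n` at most the product over all primes up to `N`,
times a factor bounded in terms of `log n / N`. -/
theorem prod_primeFactors_le (n N : ℕ) (hn : n ≠ 0) (hN : 0 < N) :
    ∏ p ∈ n.primeFactors, (1 - 1 / (p : ℝ))⁻¹ ≤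
      (∏ p ∈ N.primesLE, (1 - 1 / (p : ℝ))⁻¹) *
        Real.exp (2 / Real.log 2 * (Real.log n / N)) := by
  have hN0 : (0 : ℝ) < N := by exact_mod_cast hN
  have hone : ∀ p ∈ n.primeFactors, 1 ≤ (1 - 1 / (p : ℝ))⁻¹ := fun p hp ↦
    one_le_one_sub_one_div_inv (Nat.prime_of_mem_primeFactors hp)
  rw [← Finset.prod_filter_mul_prod_filter_not n.primeFactors (fun p ↦ p ≤ N)]
  refine mul_le_mul ?_ ?_ ?_ ?_
  · refine Finset.prod_le_prod_of_subset_of_one_le (fun p hp ↦ ?_) (fun p hp ↦ ?_) fun p hp _ ↦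
      one_le_one_sub_one_div_inv (Nat.prime_of_mem_primesLE hp)
    · rw [Finset.mem_filter] at hp
      exact Nat.mem_primesLE.2 ⟨hp.2, Nat.prime_of_mem_primeFactors hp.1⟩
    · exact zero_le_one.trans (hone p (Finset.mem_filter.1 hp).1)
  · calc ∏ p ∈ n.primeFactors with ¬ p ≤ N, (1 - 1 / (p : ℝ))⁻¹
        ≤ ∏ p ∈ n.primeFactors with ¬ p ≤ N, Real.exp (2 / N) := by
          refine Finset.prod_le_prod (fun p hp ↦ zero_le_one.trans
            (hone p (Finset.mem_filter.1 hp).1)) fun p hp ↦ ?_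
          obtain ⟨hp, hpN⟩ := Finset.mem_filter.1 hp
          have hpN' : (N : ℝ) ≤ p := by exact_mod_cast (not_le.1 hpN).le
          refine (one_sub_one_div_inv_le_exp
            (by exact_mod_cast (Nat.prime_of_mem_primeFactors hp).two_le)).trans ?_
          gcongr
      _ = Real.exp ((n.primeFactors.filter fun p ↦ ¬ p ≤ N).card * (2 / N)) := by
          rw [Finset.prod_const, Real.exp_nat_mul]
      _ ≤ Real.exp (2 / Real.log 2 * (Real.log n / N)) := by
          refine Real.exp_le_exp.2 ?_
          calc ((n.primeFactors.filter fun p ↦ ¬ p ≤ N).card : ℝ) * (2 / N)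
              ≤ Real.log n / Real.log 2 * (2 / N) := by
                gcongr
                refine le_trans ?_ (card_primeFactors_le_log_div n hn)
                exact_mod_cast Finset.card_filter_le _ _
            _ = _ := by ring
  · exact Finset.prod_nonneg fun p hp ↦ zero_le_one.trans (hone p (Finset.mem_filter.1 hp).1)
  · exact Finset.prod_nonneg fun p hp ↦
      zero_le_one.trans (one_le_one_sub_one_div_inv (Nat.prime_of_mem_primesLE hp))

/-- The product of all differences of distinct elements of `D`, up to sign. -/
noncomputable def diffProd (D : Finset ℤ) : ℕ := ∏ x ∈ D.offDiag, (x.1 - x.2).natAbs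

theorem diffProd_ne_zero (D : Finset ℤ) : diffProd D ≠ 0 :=
  Finset.prod_ne_zero_iff.2 fun x hx ↦ by
    rw [Finset.mem_offDiag] at hx
    exact Int.natAbs_ne_zero.2 (sub_ne_zero.2 hx.2.2)

theorem log_diffProd_le {D : Finset ℤ} {h : ℝ} (hh : 1 ≤ h)
    (hD : ∀ d ∈ D, (1 : ℝ) ≤ (d : ℝ) ∧ (d : ℝ) ≤ h) :
    Real.log (diffProd D) ≤ (D.card : ℝ) ^ 2 * Real.log h := by
  have hne : ∀ x ∈ D.offDiag, (((x.1 - x.2).natAbs : ℕ) : ℝ) ≠ 0 := fun x hx ↦ by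
    exact_mod_cast Finset.prod_ne_zero_iff.1 (diffProd_ne_zero D) x hx
  rw [diffProd, Nat.cast_prod, Real.log_prod hne]
  calc ∑ x ∈ D.offDiag, Real.log ((x.1 - x.2).natAbs : ℕ)
      ≤ ∑ x ∈ D.offDiag, Real.log h := by
        refine Finset.sum_le_sum fun x hx ↦
          Real.log_le_log (lt_of_le_of_ne (by positivity) (hne x hx).symm) ?_
        rw [Finset.mem_offDiag] at hx
        rw [Nat.cast_natAbs, Int.cast_abs, Int.cast_sub, abs_le]
        have h1 := hD _ hx.1
        have h2 := hD _ hx.2.1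
        constructor <;> linarith
    _ = D.offDiag.card * Real.log h := by rw [Finset.sum_const, nsmul_eq_mul]
    _ ≤ (D.card : ℝ) ^ 2 * Real.log h := by
        refine mul_le_mul_of_nonneg_right ?_ (Real.log_nonneg hh)
        have : D.offDiag.card ≤ D.card ^ 2 := by
          rw [Finset.offDiag_card, sq]
          exact Nat.sub_le _ _
        exact_mod_cast this

theorem nuD_eq_card_of_not_dvd {D : Finset ℤ} {p : ℕ} (h : ¬ p ∣ diffProd D) :
    nuD D p = D.card := by
  refine Finset.card_image_of_injOn fun a ha b hb hab ↦ ?_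
  by_contra hne
  have hmem : (a, b) ∈ D.offDiag := Finset.mem_offDiag.2 ⟨ha, hb, hne⟩
  exact h ((Int.natCast_dvd.1 ((ZMod.intCast_eq_intCast_iff_dvd_sub b a p).1 hab.symm)).trans
    (Finset.dvd_prod_of_mem (fun x : ℤ × ℤ ↦ (x.1 - x.2).natAbs) hmem))

theorem nuD_le {D : Finset ℤ} {p : ℕ} (hp : p.Prime) : nuD D p ≤ p := by
  have : NeZero p := ⟨hp.ne_zero⟩
  simpa [nuD] using Finset.card_le_univ (D.image fun d ↦ (Int.cast d : ZMod p))

/-- The local factor of the singular series at `p`. -/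
noncomputable def singFactor (D : Finset ℤ) (p : ℕ) : ℝ :=
  (1 - 1 / (p : ℝ))⁻¹ ^ D.card * (1 - (nuD D p : ℝ) / p)

theorem singFactor_nonneg (D : Finset ℤ) {p : ℕ} (hp : p.Prime) : 0 ≤ singFactor D p := by
  have hp0 : (0 : ℝ) < p := by exact_mod_cast hp.pos
  refine mul_nonneg (pow_nonneg (zero_le_one.trans (one_le_one_sub_one_div_inv hp)) _) ?_
  rw [sub_nonneg, div_le_one hp0]
  exact_mod_cast nuD_le hp

theorem singFactor_le_one_of_not_dvd {D : Finset ℤ} {p : ℕ} (hp : p.Prime)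
    (h : ¬ p ∣ diffProd D) : singFactor D p ≤ 1 := by
  have h1 := one_le_one_sub_one_div_inv hp
  have hpos : 0 < 1 - 1 / (p : ℝ) := inv_pos.1 (zero_lt_one.trans_le h1)
  have hb := one_add_mul_le_pow (a := -(1 / (p : ℝ))) (by linarith) D.card
  rw [singFactor, nuD_eq_card_of_not_dvd h, inv_pow, inv_mul_le_iff₀ (by positivity), mul_one]
  calc 1 - (D.card : ℝ) / p = 1 + D.card * -(1 / (p : ℝ)) := by ring
    _ ≤ _ := hb
    _ = _ := by rw [← sub_eq_add_neg]

theorem singFactor_le {D : Finset ℤ} {p : ℕ} (hp : p.Prime) :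
    singFactor D p ≤ (1 - 1 / (p : ℝ))⁻¹ ^ (D.card - 1) := by
  rcases D.eq_empty_or_nonempty with rfl | hD
  · simp [singFactor, nuD]
  have h1 := one_le_one_sub_one_div_inv hp
  have hpos : 0 < 1 - 1 / (p : ℝ) := inv_pos.1 (zero_lt_one.trans_le h1)
  have hnu : (1 : ℝ) ≤ nuD D p := by
    exact_mod_cast Finset.card_pos.2 (hD.image fun d ↦ (Int.cast d : ZMod p))
  obtain ⟨m, hm⟩ := Nat.exists_eq_succ_of_ne_zero (Finset.card_pos.2 hD).ne'
  rw [singFactor, hm, Nat.succ_sub_one, pow_succ, mul_assoc]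
  refine mul_le_of_le_one_right (by positivity) ?_
  rw [inv_mul_le_iff₀ hpos, mul_one]
  gcongr

theorem prod_singFactor_le (D : Finset ℤ) (s : Finset Nat.Primes) :
    ∏ p ∈ s, singFactor D p ≤
      (∏ p ∈ (diffProd D).primeFactors, (1 - 1 / (p : ℝ))⁻¹) ^ (D.card - 1) := by
  set n := diffProd D
  let f : ℕ → ℝ := fun p ↦ (1 - 1 / (p : ℝ))⁻¹ ^ (D.card - 1)
  have hf : ∀ {p : ℕ}, p.Prime → 1 ≤ f p := fun hp ↦
    one_le_pow₀ (one_le_one_sub_one_div_inv hp)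
  rw [← Finset.prod_pow]
  calc ∏ p ∈ s, singFactor D p
      ≤ ∏ p ∈ s, (if (p : ℕ) ∣ n then f p else 1) := by
        refine Finset.prod_le_prod (fun p _ ↦ singFactor_nonneg D p.2) fun p _ ↦ ?_
        split_ifs with h
        · exact singFactor_le p.2
        · exact singFactor_le_one_of_not_dvd p.2 h
    _ = ∏ p ∈ (s.filter fun p : Nat.Primes ↦ (p : ℕ) ∣ n).image
          (fun p : Nat.Primes ↦ (p : ℕ)), f p := by
        rw [Finset.prod_image, Finset.prod_filter]
        exact fun p _ q _ h ↦ Nat.Primes.coe_nat_injective h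
    _ ≤ ∏ p ∈ n.primeFactors, f p := by
        refine Finset.prod_le_prod_of_subset_of_one_le (fun p hp ↦ ?_) (fun p hp ↦ ?_)
          fun p hp _ ↦ hf (Nat.prime_of_mem_primeFactors hp)
        · obtain ⟨q, hq, rfl⟩ := Finset.mem_image.1 hp
          exact Nat.mem_primeFactors.2 ⟨q.2, (Finset.mem_filter.1 hq).2, diffProd_ne_zero D⟩
        · obtain ⟨q, hq, rfl⟩ := Finset.mem_image.1 hp
          exact zero_le_one.trans (hf q.2)

/-- The infinite product is at most any common bound of the finite products. Without
convergence its value is `1`, which is the empty product. -/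
theorem tprod_le_of_forall_prod_le {ι : Type*} {f : ι → ℝ} {B : ℝ}
    (h : ∀ s : Finset ι, ∏ i ∈ s, f i ≤ B) : ∏' i, f i ≤ B := by
  by_cases hf : Multipliable f
  · exact le_of_tendsto' hf.hasProd h
  · rw [tprod_eq_one_of_not_multipliable hf]
    simpa using h ∅

theorem log_log_three_pos : 0 < Real.log (Real.log 3) :=
  Real.log_pos ((Real.lt_log_iff_exp_lt (by norm_num)).2
    (Real.exp_one_lt_d9.trans (by norm_num)))

theorem log_floor_log_add_two_le {h : ℝ} (hh : 3 ≤ h) :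
    Real.log ((⌊Real.log h⌋₊ + 2 : ℕ) : ℝ) ≤
      (Real.log 3 / Real.log (Real.log 3) + 1) * Real.log (Real.log h) := by
  have hl3 : 1 < Real.log 3 := (Real.lt_log_iff_exp_lt (by norm_num)).2
    (Real.exp_one_lt_d9.trans (by norm_num))
  have hl : Real.log 3 ≤ Real.log h := Real.log_le_log (by norm_num) hh
  have hll : Real.log (Real.log 3) ≤ Real.log (Real.log h) := Real.log_le_log (by linarith) hl
  have hfl := Nat.floor_le (show 0 ≤ Real.log h by linarith)
  have hpos := log_log_three_pos
  calc Real.log ((⌊Real.log h⌋₊ + 2 : ℕ) : ℝ) ≤ Real.log (3 * Real.log h) := by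
        refine Real.log_le_log (by positivity) ?_
        push_cast
        linarith
    _ = Real.log 3 + Real.log (Real.log h) :=
        Real.log_mul (by norm_num) (by linarith)
    _ ≤ _ := by
        rw [add_mul, one_mul]
        gcongr
        rw [div_mul_eq_mul_div, le_div_iff₀ hpos]
        gcongr

theorem singSeries_upper_bound (k : ℕ) :
    ∃ C : ℝ, ∀ h : ℝ, 3 ≤ h → ∀ D : Finset ℤ, D.card = k →
      (∀ d ∈ D, (1 : ℝ) ≤ (d : ℝ) ∧ (d : ℝ) ≤ h) →
      singSeries D ≤ C * Real.log (Real.log h) ^ (k - 1) := by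
  obtain ⟨C, hC, hmertens⟩ := exists_prod_primesLE_le_log
  set c := Real.log 3 / Real.log (Real.log 3) + 1
  set E := Real.exp (2 / Real.log 2 * (k : ℝ) ^ 2)
  refine ⟨(C * c * E) ^ (k - 1), fun h hh D hk hD ↦ ?_⟩
  refine tprod_le_of_forall_prod_le fun s ↦ (prod_singFactor_le D s).trans ?_
  rw [hk, ← mul_pow]
  refine pow_le_pow_left₀ (Finset.prod_nonneg fun p hp ↦ zero_le_one.trans
    (one_le_one_sub_one_div_inv (Nat.prime_of_mem_primeFactors hp))) ?_ _
  set N := ⌊Real.log h⌋₊ + 2 with hN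
  have hlog : 0 < Real.log h := Real.log_pos (by linarith)
  have hNlog : Real.log h ≤ N := by
    have := (Nat.lt_floor_add_one (Real.log h)).le
    rw [hN]
    push_cast
    linarith
  have hratio : Real.log (diffProd D) / N ≤ (k : ℝ) ^ 2 := by
    rw [div_le_iff₀ (hlog.trans_le hNlog), ← hk]
    exact (log_diffProd_le (by linarith) hD).trans (by gcongr)
  calc ∏ p ∈ (diffProd D).primeFactors, (1 - 1 / (p : ℝ))⁻¹
      ≤ (∏ p ∈ N.primesLE, (1 - 1 / (p : ℝ))⁻¹) *
        Real.exp (2 / Real.log 2 * (Real.log (diffProd D) / N)) :=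
        prod_primeFactors_le _ N (diffProd_ne_zero D) (by omega)
    _ ≤ (C * Real.log N) * E := by
        have := Real.log_pos one_lt_two
        gcongr
        · exact hmertens N (by omega)
        · exact Real.exp_le_exp.2 (by gcongr)
    _ ≤ (C * (c * Real.log (Real.log h))) * E := by
        gcongr
        exact log_floor_log_add_two_le hh
    _ = C * c * E * Real.log (Real.log h) := by ring
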